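/- arXiv:1506.05283 — 2 statements merged into one kernel-verified Lean document; each statement's English description precedes it below -/
import Mathlib

section
/- Let X1 and X2 be perpendicular subsets of the generating set S = {δ_{i,j} : 1 ≤ i ≠ j ≤ n} of KB_n (i.e., supp(X1) ∩ supp(X2) = ∅, where supp(δ_{i,j}) = {i,j}), and let X = X1 ∪ X2. Then KB_n(X) is isomorphic to the direct product KB_n(X1) × KB_n(X2), where KB_n(Y) denotes the subgroup of KB_n generated by Y. -/
/-! The group `KB n`, presented with generators `δ_{i,j}` for `i ≠ j` in `Fin n`, and
relations `δ_{i,j}δ_{k,l} = δ_{k,l}δ_{i,j}` for `i,j,k,l` distinct and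
`δ_{i,j}δ_{j,k}δ_{i,j} = δ_{j,k}δ_{i,j}δ_{j,k}` for `i,j,k` distinct. -/

/-- The generating set `S = {δ_{i,j} : i ≠ j}`, encoded as pairs of distinct indices. -/
abbrev KBGen (n : ℕ) := {p : Fin n × Fin n // p.1 ≠ p.2}

/-- The free-group generator `δ_{i,j}`. -/
def deltaF {n : ℕ} (i j : Fin n) (h : i ≠ j) : FreeGroup (KBGen n) := FreeGroup.of ⟨(i, j), h⟩

/-- The defining relators of `KB n`. -/
def KBRels (n : ℕ) : Set (FreeGroup (KBGen n)) :=
  {r | (∃ (i j k l : Fin n) (hij : i ≠ j) (hkl : k ≠ l),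
          i ≠ k ∧ i ≠ l ∧ j ≠ k ∧ j ≠ l ∧
          r = deltaF i j hij * deltaF k l hkl * (deltaF k l hkl * deltaF i j hij)⁻¹) ∨
       (∃ (i j k : Fin n) (hij : i ≠ j) (hjk : j ≠ k) (_ : i ≠ k),
          r = deltaF i j hij * deltaF j k hjk * deltaF i j hij *
            (deltaF j k hjk * deltaF i j hij * deltaF j k hjk)⁻¹)}

/-- The group `KB n` (the kernel of `VB_n → S_n`, via Rabenda's presentation). -/
abbrev KB (n : ℕ) := PresentedGroup (KBRels n)

/-- The generator `δ_{i,j}` of `KB n`. -/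
def deltaK {n : ℕ} (i j : Fin n) (h : i ≠ j) : KB n := PresentedGroup.of ⟨(i, j), h⟩

/-- The subgroup `KB_n(Y)` generated by a subset `Y` of the generating set. -/
def KBsub {n : ℕ} (Y : Set (KBGen n)) : Subgroup (KB n) :=
  Subgroup.closure (PresentedGroup.of '' Y)

/-- The support of the generator `δ_{i,j}` is `{i, j}`. -/
def KBsupp {n : ℕ} (s : KBGen n) : Set (Fin n) := {s.1.1, s.1.2}

/-- The support of a subset of the generating set. -/
def KBsuppSet {n : ℕ} (X : Set (KBGen n)) : Set (Fin n) := ⋃ s ∈ X, KBsupp s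

open Classical in
/-- Label of a pair. -/
noncomputable def kbLab {n : ℕ} (a b : Fin n) : KB n := if h : a ≠ b then deltaK a b h else 1

theorem kbLab_comm {n : ℕ} (i j k l : Fin n) (hij : i ≠ j) (hkl : k ≠ l) (h1 : i ≠ k) (h2 : i ≠ l)
    (h3 : j ≠ k) (h4 : j ≠ l) : kbLab i j * kbLab k l = kbLab k l * kbLab i j := by
  have := PresentedGroup.one_of_mem (rels := KBRels n)
    (Or.inl ⟨i, j, k, l, hij, hkl, h1, h2, h3, h4, rfl⟩)
  rw [map_mul, map_inv, mul_inv_eq_one, map_mul, map_mul] at this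
  simp only [kbLab, hij, hkl, ne_eq, not_false_eq_true, dite_true]
  exact this

theorem kbLab_braid {n : ℕ} (i j k : Fin n) (hij : i ≠ j) (hjk : j ≠ k) (hik : i ≠ k) :
    kbLab i j * (kbLab j k * kbLab i j) = kbLab j k * (kbLab i j * kbLab j k) := by
  have := PresentedGroup.one_of_mem (rels := KBRels n)
    (Or.inr ⟨i, j, k, hij, hjk, hik, rfl⟩)
  rw [map_mul, map_inv, mul_inv_eq_one, map_mul, map_mul, map_mul, map_mul] at this
  rw [mul_assoc, mul_assoc] at this
  simp only [kbLab, hij, hjk, ne_eq, not_false_eq_true, dite_true]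
  exact this

open Classical in
/-- The generator `δ_{i,j}` acting on states (twisted by the label raised to `e`). -/
noncomputable def kbAct {n : ℕ} (A : Set (Fin n)) (e : KB n → KB n) (i j : Fin n)
    (x : Equiv.Perm (Fin n) × KB n) : Equiv.Perm (Fin n) × KB n :=
  if x.1 i ∈ A then
    if x.1 j ∈ A then (x.1, e (kbLab (x.1 i) (x.1 j)) * x.2) else (x.1 * Equiv.swap i j, x.2)
  else
    if x.1 j ∈ A then (x.1 * Equiv.swap i j, x.2) else x

/-- The action as a permutation. -/
noncomputable def kbPerm {n : ℕ} (A : Set (Fin n)) (i j : Fin n) :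
    Equiv.Perm (Equiv.Perm (Fin n) × KB n) where
  toFun := kbAct A id i j
  invFun := kbAct A (fun g => g⁻¹) i j
  left_inv := by
    rintro ⟨σ, g⟩
    by_cases h1 : σ i ∈ A <;> by_cases h2 : σ j ∈ A <;> simp [kbAct, h1, h2, mul_assoc]
  right_inv := by
    rintro ⟨σ, g⟩
    by_cases h1 : σ i ∈ A <;> by_cases h2 : σ j ∈ A <;> simp [kbAct, h1, h2, mul_assoc]

theorem swap_braid {n : ℕ} (i j k : Fin n) (hij : i ≠ j) (hjk : j ≠ k) (hik : i ≠ k) :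
    Equiv.swap i j * (Equiv.swap j k * Equiv.swap i j) =
      Equiv.swap j k * (Equiv.swap i j * Equiv.swap j k) := by
  ext x
  simp only [Equiv.Perm.mul_apply, Equiv.swap_apply_def]
  grind

theorem swap_disj {n : ℕ} (i j k l : Fin n) (h1 : i ≠ k) (h2 : i ≠ l)
    (h3 : j ≠ k) (h4 : j ≠ l) :
    Equiv.swap i j * Equiv.swap k l = Equiv.swap k l * Equiv.swap i j := by
  ext x
  simp only [Equiv.Perm.mul_apply, Equiv.swap_apply_def]
  grind

theorem kbPerm_comm {n : ℕ} (A : Set (Fin n)) (i j k l : Fin n) (hij : i ≠ j) (hkl : k ≠ l)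
    (h1 : i ≠ k) (h2 : i ≠ l) (h3 : j ≠ k) (h4 : j ≠ l) :
    kbPerm A i j * kbPerm A k l = kbPerm A k l * kbPerm A i j := by
  ext1 ⟨σ, g⟩
  have hs := swap_disj i j k l h1 h2 h3 h4
  have hl := kbLab_comm (σ i) (σ j) (σ k) (σ l) (by simpa) (by simpa) (by simpa) (by simpa)
    (by simpa) (by simpa)
  by_cases a1 : σ i ∈ A <;> by_cases a2 : σ j ∈ A <;> by_cases a3 : σ k ∈ A <;>
    by_cases a4 : σ l ∈ A <;>
    simp [kbPerm, kbAct, a1, a2, a3, a4, Equiv.swap_apply_of_ne_of_ne, h1, h2, h3, h4, h1.symm,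
      h2.symm, h3.symm, h4.symm, mul_assoc, hs] <;>
    simp [← mul_assoc, hl]

theorem kbPerm_braid {n : ℕ} (A : Set (Fin n)) (i j k : Fin n) (hij : i ≠ j) (hjk : j ≠ k)
    (hik : i ≠ k) :
    kbPerm A i j * kbPerm A j k * kbPerm A i j = kbPerm A j k * kbPerm A i j * kbPerm A j k := by
  ext1 ⟨σ, g⟩
  have hs := swap_braid i j k hij hjk hik
  have hl := kbLab_braid (σ i) (σ j) (σ k) (by simpa) (by simpa) (by simpa)
  by_cases a1 : σ i ∈ A <;> by_cases a2 : σ j ∈ A <;> by_cases a3 : σ k ∈ A <;>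
    simp [kbPerm, kbAct, a1, a2, a3, Equiv.swap_apply_of_ne_of_ne, hij, hjk, hik, hij.symm,
      hjk.symm, hik.symm, mul_assoc, hs]
  simpa [mul_assoc] using congrArg (· * g) hl

/-- The action as a homomorphism. -/
noncomputable def kbHom {n : ℕ} (A : Set (Fin n)) :
    KB n →* Equiv.Perm (Equiv.Perm (Fin n) × KB n) :=
  PresentedGroup.toGroup (rels := KBRels n) (f := fun s => kbPerm A s.1.1 s.1.2) (by
    rintro r (⟨i, j, k, l, hij, hkl, h1, h2, h3, h4, rfl⟩ | ⟨i, j, k, hij, hjk, hik, rfl⟩)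
    · rw [map_mul, map_inv, mul_inv_eq_one]
      simpa [deltaF] using kbPerm_comm A i j k l hij hkl h1 h2 h3 h4
    · rw [map_mul, map_inv, mul_inv_eq_one]
      simpa [deltaF] using kbPerm_braid A i j k hij hjk hik)

theorem kbHom_of {n : ℕ} (A : Set (Fin n)) (s : KBGen n) :
    kbHom A (PresentedGroup.of s) = kbPerm A s.1.1 s.1.2 :=
  PresentedGroup.toGroup.of _

theorem kbHom_left {n : ℕ} (A : Set (Fin n)) (X : Set (KBGen n))
    (hX : ∀ s ∈ X, s.1.1 ∈ A ∧ s.1.2 ∈ A) (w : KB n) (hw : w ∈ KBsub X) :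
    ∀ g, kbHom A w (1, g) = (1, w * g) := by
  induction hw using Subgroup.closure_induction with
  | mem x hx =>
    obtain ⟨s, hs, rfl⟩ := hx
    intro g
    simp [kbHom_of, kbPerm, kbAct, hX s hs, kbLab, s.2, deltaK]
  | one => simp
  | mul x y _ _ hx hy => intro g; simp [hx, hy, mul_assoc]
  | inv x _ hx =>
    intro g
    rw [map_inv, Equiv.Perm.inv_eq_iff_eq, hx]
    simp

theorem kbHom_right {n : ℕ} (A : Set (Fin n)) (X : Set (KBGen n))
    (hX : ∀ s ∈ X, s.1.1 ∉ A ∧ s.1.2 ∉ A) (w : KB n) (hw : w ∈ KBsub X) :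
    ∀ g, kbHom A w (1, g) = (1, g) := by
  induction hw using Subgroup.closure_induction with
  | mem x hx =>
    obtain ⟨s, hs, rfl⟩ := hx
    intro g
    simp [kbHom_of, kbPerm, kbAct, hX s hs]
  | one => simp
  | mul x y _ _ hx hy => intro g; simp [hx, hy]
  | inv x _ hx =>
    intro g
    rw [map_inv, Equiv.Perm.inv_eq_iff_eq, hx]

/-- If `X1` and `X2` are perpendicular subsets of the generating set of
`KB_n` (their supports are disjoint), then the subgroup `KB_n(X1 ∪ X2)` is isomorphic to
the direct product `KB_n(X1) × KB_n(X2)`. -/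
theorem KBsub_union_perpendicular (n : ℕ) (X1 X2 : Set (KBGen n))
    (hperp : Disjoint (KBsuppSet X1) (KBsuppSet X2)) :
    Nonempty (↥(KBsub (X1 ∪ X2)) ≃* ↥(KBsub X1) × ↥(KBsub X2)) := by
  have m : ∀ (X : Set (KBGen n)), ∀ s ∈ X, s.1.1 ∈ KBsuppSet X ∧ s.1.2 ∈ KBsuppSet X := by
    intro X s hs
    simp only [KBsuppSet, Set.mem_iUnion]
    exact ⟨⟨s, hs, by simp [KBsupp]⟩, ⟨s, hs, by simp [KBsupp]⟩⟩
  have hd := Set.disjoint_right.1 hperp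
  have hdis : Disjoint (KBsub X1) (KBsub X2) := by
    rw [Subgroup.disjoint_def]
    intro w h1 h2
    have e1 := kbHom_left (KBsuppSet X1) X1 (m X1) w h1 1
    have e2 := kbHom_right (KBsuppSet X1) X2
      (fun s hs => ⟨hd (m X2 s hs).1, hd (m X2 s hs).2⟩) w h2 1
    rw [e1] at e2
    simpa using e2
  have hgen : ∀ x ∈ (PresentedGroup.of '' X1 : Set (KB n)),
      ∀ y ∈ (PresentedGroup.of '' X2 : Set (KB n)), x * y = y * x := by
    rintro _ ⟨s, hs, rfl⟩ _ ⟨t, ht, rfl⟩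
    have a := m X1 s hs
    have b := m X2 t ht
    have key : ∀ p ∈ KBsuppSet X1, ∀ q ∈ KBsuppSet X2, p ≠ q := by
      rintro p hp q hq rfl
      exact hd hq hp
    have := kbLab_comm s.1.1 s.1.2 t.1.1 t.1.2 s.2 t.2 (key _ a.1 _ b.1) (key _ a.1 _ b.2)
      (key _ a.2 _ b.1) (key _ a.2 _ b.2)
    simpa [kbLab, s.2, t.2, deltaK] using this
  have hle : KBsub X2 ≤ Subgroup.centralizer (KBsub X1 : Set (KB n)) := by
    unfold KBsub
    rw [Subgroup.centralizer_closure, Subgroup.closure_le]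
    intro y hy
    exact Subgroup.mem_centralizer_iff.2 fun x hx => hgen x hx y hy
  have hcomm : ∀ (x : KBsub X1) (y : KBsub X2),
      Commute ((KBsub X1).subtype x) ((KBsub X2).subtype y) := by
    intro x y
    exact Subgroup.mem_centralizer_iff.1 (hle y.2) x x.2
  let f := MonoidHom.noncommCoprod (KBsub X1).subtype (KBsub X2).subtype hcomm
  have hinj : Function.Injective f := by
    rw [MonoidHom.noncommCoprod_injective]
    refine ⟨Subgroup.subtype_injective _, Subgroup.subtype_injective _, ?_⟩
    simpa using hdis
  have hr : f.range = KBsub (X1 ∪ X2) := by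
    rw [MonoidHom.noncommCoprod_range, Subgroup.range_subtype, Subgroup.range_subtype]
    simp [KBsub, Set.image_union, Subgroup.closure_union]
  exact ⟨((MonoidHom.ofInjective hinj).trans (MulEquiv.subgroupCongr hr)).symm⟩
end

section
/- Let W be a Coxeter group with generating set S and let g ∈ W. Then: (1) an expression of g as a word over S is reduced (of minimal length) if and only if its length cannot be shortened by deleting a factor ss (s ∈ S) or applying a braid relation ⟨s,t⟩^{m_{s,t}} = ⟨t,s⟩^{m_{s,t}}; and (2) any two reduced expressions of g are connected by a finite sequence of braid-relation substitutions. -/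
/-- The alternating word `⟨s,t⟩^m = sts⋯` of length `m`. -/
def altWord {B : Type*} (s t : B) : ℕ → List B
  | 0 => []
  | m + 1 => s :: altWord t s m

/-- An M-operation of type I: delete a subword `ss`. -/
def delMove {B : Type*} (w1 w2 : List B) : Prop :=
  ∃ (u v : List B) (s : B), w1 = u ++ s :: s :: v ∧ w2 = u ++ v

/-- An M-operation of type II (braid-relation substitution): replace a subword
`⟨s,t⟩^{m_{s,t}}` by `⟨t,s⟩^{m_{s,t}}`, when `m_{s,t} ≠ ∞` (in `CoxeterMatrix`
conventions, `M s t = 0` encodes `m_{s,t} = ∞`). -/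
def braidMove {B : Type*} (M : CoxeterMatrix B) (w1 w2 : List B) : Prop :=
  ∃ (u v : List B) (s t : B), M s t ≠ 0 ∧
    w1 = u ++ altWord s t (M s t) ++ v ∧ w2 = u ++ altWord t s (M s t) ++ v

/-- A word is M-reduced when its length cannot be shortened by M-operations of
types I and II. -/
def MReduced {B : Type*} (M : CoxeterMatrix B) (w : List B) : Prop :=
  ∀ w' : List B,
    Relation.ReflTransGen (fun a b => delMove a b ∨ braidMove M a b) w w' →
      w.length ≤ w'.length

namespace TitsAux

open CoxeterSystem Polynomial

/-! ### The geometric representation and the order of `s t` -/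

section Geometric

variable {B : Type*} (M : CoxeterMatrix B)

/-- Entries of the (rescaled) Tits bilinear form. -/
noncomputable def coef (i j : B) : ℝ := -2 * Real.cos (Real.pi / M i j)

theorem coef_self (i : B) : coef M i i = 2 := by simp [coef]

theorem coef_symm (i j : B) : coef M i j = coef M j i := by simp [coef, M.symmetric i j]

/-- The functional attached to `i`. -/
noncomputable def func (i : B) : Module.Dual ℝ (B →₀ ℝ) :=
  Finsupp.linearCombination ℝ (coef M i)

theorem func_single (i j : B) : func M i (Finsupp.single j 1) = coef M i j := by
  simp [func]

theorem func_self (i : B) : func M i (Finsupp.single i 1) = 2 := by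
  rw [func_single, coef_self]

/-- The reflection attached to `i`. -/
noncomputable def refl (i : B) : (B →₀ ℝ) ≃ₗ[ℝ] (B →₀ ℝ) := Module.reflection (func_self M i)

theorem coef_mul (i j : B) :
    func M i (Finsupp.single j 1) * func M j (Finsupp.single i 1) - 2
      = 2 * Real.cos (2 * Real.pi / M i j) := by
  rw [func_single, func_single, coef_symm M j i, coef, mul_div_assoc, Real.cos_two_mul]
  ring

theorem sin_pos_of {m : ℕ} (hm : 3 ≤ m) : 0 < Real.sin (2 * Real.pi / m) := by
  have h3 : (3 : ℝ) ≤ m := by exact_mod_cast hm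
  apply Real.sin_pos_of_pos_of_lt_pi
  · have := Real.pi_pos; positivity
  · rw [div_lt_iff₀ (by linarith)]
    nlinarith [Real.pi_pos]

theorem refl_pow (i j : B) : (refl M i * refl M j) ^ M i j = 1 := by
  by_cases hij : i = j
  · subst hij
    rw [M.diagonal, pow_one]
    ext1 z
    exact Module.involutive_reflection (func_self M i) z
  have h1 : M i j ≠ 1 := M.off_diagonal i j hij
  ext1 z
  have key := Module.reflection_mul_reflection_pow_apply (func_self M i) (func_self M j) (M i j) z
    (2 * Real.cos (2 * Real.pi / M i j)) (coef_mul M i j).symm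
  change ((refl M i * refl M j) ^ M i j) z = _ at key
  rw [key]
  change _ = z
  rcases Nat.lt_or_ge (M i j) 3 with h3 | h3
  · have : M i j = 0 ∨ M i j = 2 := by omega
    rcases this with h | h
    · simp [h]
    · have hc : coef M i j = 0 := by simp [coef, h]
      have hc' : coef M j i = 0 := by rw [coef_symm, hc]
      have e : 2 * Real.cos (2 * Real.pi / (M i j : ℕ)) = -2 := by simp [h]
      rw [e]
      simp only [func_single, hc, hc', h]
      norm_num
      abel
  · have hs := sin_pos_of h3
    set θ := 2 * Real.pi / M i j with hθ
    have hm0 : ((M i j : ℕ) : ℝ) ≠ 0 := by positivity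
    rcases Nat.even_or_odd' (M i j) with ⟨k, hk | hk⟩
    · have hz : (Chebyshev.S ℝ ((k : ℤ) - 1)).eval (2 * Real.cos θ) = 0 := by
        have := Chebyshev.S_two_mul_real_cos θ ((k : ℤ) - 1)
        have e : (((((k : ℤ) - 1 : ℤ) : ℝ)) + 1) * θ = Real.pi := by
          rw [hθ, hk]
          have hk0 : (k : ℝ) ≠ 0 := by
            have : k ≠ 0 := by omega
            exact_mod_cast this
          push_cast; field_simp; ring
        rw [e, Real.sin_pi] at this
        exact (mul_eq_zero.mp this).resolve_right hs.ne'
      have e1 : (((M i j : ℕ) : ℤ) - 2) / 2 = k - 1 := by omega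
      have e2 : (((M i j : ℕ) : ℤ) - 1) / 2 = k - 1 := by omega
      rw [e1, e2, hz]
      simp
    · have hz : (Chebyshev.S ℝ (k : ℤ)).eval (2 * Real.cos θ) +
          (Chebyshev.S ℝ ((k : ℤ) - 1)).eval (2 * Real.cos θ) = 0 := by
        have a1 := Chebyshev.S_two_mul_real_cos θ ((k : ℤ) - 1)
        have a2 := Chebyshev.S_two_mul_real_cos θ (k : ℤ)
        have e : (((k : ℤ) : ℝ) + 1) * θ = 2 * Real.pi - k * θ := by
          rw [hθ, hk]; rw [hk] at hm0; push_cast at hm0 ⊢; field_simp; ring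
        rw [e, Real.sin_two_pi_sub] at a2
        have e' : (((((k : ℤ) - 1 : ℤ) : ℝ)) + 1) * θ = k * θ := by push_cast; ring
        rw [e'] at a1
        refine (mul_eq_zero.mp (?_ : _ * Real.sin θ = 0)).resolve_right hs.ne'
        rw [add_mul, a1, a2]; ring
      have e1 : (((M i j : ℕ) : ℤ) - 2) / 2 = k - 1 := by omega
      have e2 : (((M i j : ℕ) : ℤ) - 1) / 2 = k := by omega
      have e3 : (((M i j : ℕ) : ℤ) - 3) / 2 = k - 1 := by omega
      have e4 : (((M i j : ℕ) : ℤ)) / 2 = k := by omega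
      rw [e1, e2, e3, e4, hz]
      simp

theorem dvd_of_refl_pow {i j : B} (hij : i ≠ j) (p : ℕ) (h : (refl M i * refl M j) ^ p = 1) :
    M i j ∣ p := by
  have h1 : M i j ≠ 1 := M.off_diagonal i j hij
  have key := Module.reflection_mul_reflection_pow_apply_self (func_self M i) (func_self M j) p
    (2 * Real.cos (2 * Real.pi / M i j)) (coef_mul M i j).symm
  change ((refl M i * refl M j) ^ p) _ = _ at key
  rw [h] at key
  change Finsupp.single i (1 : ℝ) = _ at key
  have ki := DFunLike.congr_fun key i
  have kj := DFunLike.congr_fun key j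
  simp [hij, hij.symm, func_single] at ki kj
  rcases Nat.lt_or_ge (M i j) 3 with h3 | h3
  · have : M i j = 0 ∨ M i j = 2 := by omega
    rcases this with h | h
    · have hc : coef M j i = -2 := by rw [coef_symm]; simp [coef, h]
      rw [h, hc] at kj
      simp [Chebyshev.S_eval_two] at kj
      simp [kj]
    · rw [h] at ki ⊢
      have e : 2 * Real.cos (2 * Real.pi / (2 : ℕ)) = -2 := by simp
      rw [e, Chebyshev.S_eval_neg_two, Chebyshev.S_eval_neg_two] at ki
      by_contra hp
      have hodd : Odd (p : ℤ) := by
        rw [Int.odd_iff]; omega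
      have heven : Even ((p : ℤ) - 1) := by
        rw [Int.even_iff]; rw [Int.odd_iff] at hodd; omega
      rw [Int.negOnePow_odd _ hodd, Int.negOnePow_even _ heven] at ki
      push_cast at ki
      norm_num at ki
  · have hs := sin_pos_of h3
    have hc : coef M j i ≠ 0 := by
      rw [coef_symm, coef]
      have h3' : (3 : ℝ) ≤ M i j := by exact_mod_cast h3
      have : 0 < Real.cos (Real.pi / M i j) := by
        apply Real.cos_pos_of_mem_Ioo
        constructor
        · have := Real.pi_pos
          have : 0 < Real.pi / M i j := by positivity
          linarith
        · apply div_lt_div_of_pos_left Real.pi_pos (by norm_num) (by linarith)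
      linarith
    set θ := 2 * Real.pi / M i j with hθ
    have hm0 : ((M i j : ℕ) : ℝ) ≠ 0 := by positivity
    have hz := kj.resolve_right hc
    rw [hz, add_zero] at ki
    have a1 := Chebyshev.S_two_mul_real_cos θ ((p : ℤ) - 1)
    have a2 := Chebyshev.S_two_mul_real_cos θ (p : ℤ)
    rw [hz, zero_mul] at a1
    rw [← ki, one_mul] at a2
    have e' : (((((p : ℤ) - 1 : ℤ) : ℝ)) + 1) * θ = p * θ := by push_cast; ring
    have e : (((p : ℤ) : ℝ) + 1) * θ = p * θ + θ := by push_cast; ring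
    rw [e'] at a1
    rw [e, Real.sin_add, ← a1, zero_mul, zero_add] at a2
    have hcos : Real.cos (p * θ) = 1 := by
      have : (Real.cos (p * θ) - 1) * Real.sin θ = 0 := by linarith
      have := (mul_eq_zero.mp this).resolve_right hs.ne'
      linarith
    obtain ⟨n, hn⟩ := (Real.cos_eq_one_iff _).mp hcos
    have : (n : ℝ) * M i j = p := by
      rw [hθ] at hn
      have hpi := Real.pi_ne_zero
      field_simp at hn
      linarith
    have : (n : ℤ) * M i j = p := by exact_mod_cast this
    exact Int.natCast_dvd_natCast.mp ⟨n, by rw [← this]; ring⟩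

theorem dvd_of_pow_eq_one {W : Type*} [Group W] {M : CoxeterMatrix B} (cs : CoxeterSystem M W)
    {i j : B} (hij : i ≠ j) (p : ℕ) (h : (cs.simple i * cs.simple j) ^ p = 1) : M i j ∣ p := by
  apply dvd_of_refl_pow M hij p
  have hl : M.IsLiftable (refl M) := refl_pow M
  have := congrArg (cs.lift ⟨refl M, hl⟩) h
  simpa [cs.lift_apply_simple hl] using this

end Geometric

/-! ### The exchange property -/

section Exchange

variable {B W : Type*} [Group W] {M : CoxeterMatrix B} (cs : CoxeterSystem M W)

theorem leftInvSeq_altWord (i j : B) (k : ℕ) :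
    cs.leftInvSeq (altWord i j k) =
      (List.range k).map (fun p => (cs.simple i * cs.simple j) ^ p * cs.simple i) := by
  induction k generalizing i j with
  | zero => rfl
  | succ k ih =>
    rw [altWord, leftInvSeq, ih, List.range_succ_eq_map, List.map_cons, List.map_map,
      List.map_map]
    congr 1
    · simp
    · apply List.map_congr_left
      intro p _
      simp only [Function.comp_apply, MulAut.conj_apply, inv_simple]
      have : cs.simple i * (cs.simple j * cs.simple i) ^ p
          = (cs.simple i * cs.simple j) ^ p * cs.simple i := by
        clear ih
        induction p with
        | zero => simp
        | succ p ih =>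
          rw [pow_succ, ← mul_assoc, ih (by simp_all; omega), pow_succ]; simp only [mul_assoc]
      rw [← mul_assoc, this, Nat.succ_eq_add_one, pow_succ]
      simp only [mul_assoc]

open Classical in
/-- The signed permutation attached to `i`. -/
noncomputable def sgn (i : B) : Function.End (W × ZMod 2) := fun x =>
  (cs.simple i * x.1 * cs.simple i, x.2 + if x.1 = cs.simple i then 1 else 0)

open Classical in
theorem sgn_word (ω : List B) (t : W) (e : ZMod 2) :
    (ω.reverse.map (sgn cs)).prod (t, e) =
      ((cs.wordProd ω)⁻¹ * t * cs.wordProd ω, e + ((cs.leftInvSeq ω).count t : ℕ)) := by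
  induction ω generalizing t e with
  | nil => simp [leftInvSeq]; rfl
  | cons i ω ih =>
    rw [List.reverse_cons, List.map_append, List.prod_append]
    change (ω.reverse.map (sgn cs)).prod ((List.map (sgn cs) [i]).prod (t, e)) = _
    have h1 : (List.map (sgn cs) [i]).prod (t, e) = sgn cs i (t, e) := by simp
    rw [h1, sgn, ih]
    have h2 : ((cs.leftInvSeq (i :: ω)).count t) =
        (cs.leftInvSeq ω).count (cs.simple i * t * cs.simple i)
          + if t = cs.simple i then 1 else 0 := by
      rw [leftInvSeq, List.count_cons]
      congr 1
      · have : t = MulAut.conj (cs.simple i) (cs.simple i * t * cs.simple i) := by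
          simp [mul_assoc]
        conv_lhs => rw [this]
        exact List.count_map_of_injective _ _ (MulAut.conj (cs.simple i)).injective _
      · by_cases ht : t = cs.simple i
        · simp [ht]
        · simp [ht, Ne.symm ht]
    rw [h2]
    ext
    · simp [wordProd_cons, mul_assoc]
    · push_cast; ring

theorem sgn_pow (i j : B) (m : ℕ) :
    (sgn cs i * sgn cs j) ^ m = (((altWord j i (2 * m)).reverse).map (sgn cs)).prod := by
  induction m with
  | zero => rfl
  | succ m ih =>
    rw [pow_succ, ih, show 2 * (m + 1) = 2 * m + 1 + 1 by ring, altWord, altWord]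
    simp [mul_assoc]

theorem wordProd_altWord_two_mul (i j : B) (m : ℕ) :
    cs.wordProd (altWord i j (2 * m)) = (cs.simple i * cs.simple j) ^ m := by
  induction m with
  | zero => simp [altWord]
  | succ m ih =>
    rw [pow_succ', ← ih, show 2 * (m + 1) = 2 * m + 1 + 1 by ring, altWord, altWord]
    simp [wordProd_cons, mul_assoc]

theorem sgn_liftable : M.IsLiftable (sgn cs) := by
  classical
  intro i j
  rw [sgn_pow]
  funext x
  obtain ⟨t, e⟩ := x
  rw [sgn_word, wordProd_altWord_two_mul, M.symmetric, simple_mul_simple_pow, leftInvSeq_altWord,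
    two_mul, List.range_add, List.map_append, List.map_map, List.count_append]
  have : List.map ((fun p => (cs.simple j * cs.simple i) ^ p * cs.simple j) ∘ fun x => M j i + x)
      (List.range (M j i)) =
      List.map (fun p => (cs.simple j * cs.simple i) ^ p * cs.simple j) (List.range (M j i)) := by
    apply List.map_congr_left
    intro p _
    simp [pow_add]
  rw [this]
  change _ = (t, e)
  ext
  · simp
  · push_cast
    rw [CharTwo.add_self_eq_zero]
    simp

theorem lift_sgn (ω : List B) :
    cs.lift ⟨sgn cs, sgn_liftable cs⟩ (cs.wordProd ω) = (ω.map (sgn cs)).prod := by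
  induction ω with
  | nil => simp
  | cons i ω ih => rw [wordProd_cons, map_mul, ih, cs.lift_apply_simple]; simp

open Classical in
theorem count_eq {ω ω' : List B} (h : cs.wordProd ω = cs.wordProd ω') (t : W) :
    (((cs.leftInvSeq ω).count t : ℕ) : ZMod 2) = ((cs.leftInvSeq ω').count t : ℕ) := by
  have h' : cs.wordProd ω.reverse = cs.wordProd ω'.reverse := by simp [h]
  have := congrArg (cs.lift ⟨sgn cs, sgn_liftable cs⟩) h'
  rw [lift_sgn, lift_sgn] at this
  have := congrArg Prod.snd (congrFun this (t, 0))
  rw [sgn_word, sgn_word] at this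
  simpa using this

/-- A reduced word starting with a given left descent. -/
theorem exists_cons {x : W} {j : B} (h : cs.IsLeftDescent x j) :
    ∃ ω, cs.IsReduced (j :: ω) ∧ cs.wordProd (j :: ω) = x := by
  obtain ⟨ω, hω, he⟩ := cs.exists_isReduced (cs.simple j * x)
  have hx : cs.wordProd (j :: ω) = x := by rw [wordProd_cons, ← he]; simp
  refine ⟨ω, ?_, hx⟩
  rw [isLeftDescent_iff] at h
  rw [CoxeterSystem.IsReduced, hx, ← h, he, hω.eq]
  simp

theorem mem_leftInvSeq {ω : List B} {j : B} (h : cs.IsLeftDescent (cs.wordProd ω) j) :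
    cs.simple j ∈ cs.leftInvSeq ω := by
  classical
  obtain ⟨ω', hr, he⟩ := exists_cons cs h
  have hc := count_eq cs he (cs.simple j)
  have h1 : (cs.leftInvSeq (j :: ω')).count (cs.simple j) = 1 :=
    List.count_eq_one_of_mem hr.nodup_leftInvSeq (by simp [leftInvSeq])
  rw [h1] at hc
  by_contra hn
  rw [List.count_eq_zero_of_not_mem hn] at hc
  simp at hc

theorem leftInvSeq_append (a b : List B) :
    cs.leftInvSeq (a ++ b) =
      cs.leftInvSeq a ++ (cs.leftInvSeq b).map (MulAut.conj (cs.wordProd a)) := by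
  induction a with
  | nil => simp [leftInvSeq]
  | cons i a ih =>
    simp only [List.cons_append, leftInvSeq, ih, List.map_append, List.map_map, wordProd_cons]
    simp [Function.comp_def, mul_assoc]

theorem length_altWord (i j : B) (k : ℕ) : (altWord i j k).length = k := by
  induction k generalizing i j with
  | zero => rfl
  | succ k ih => simp [altWord, ih]

theorem step {x : W} {i j : B} (hij : i ≠ j) (hj : cs.IsLeftDescent x j) {k : ℕ}
    (hk : M i j = 0 ∨ k < M i j) {z : List B} (hr : cs.IsReduced (altWord i j k ++ z))
    (hx : cs.wordProd (altWord i j k ++ z) = x) :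
    ∃ z', cs.IsReduced (altWord j i (k + 1) ++ z') ∧
      cs.wordProd (altWord j i (k + 1) ++ z') = x := by
  rw [← hx] at hj
  have hm := mem_leftInvSeq cs hj
  rw [leftInvSeq_append, List.mem_append] at hm
  rcases hm with hm | hm
  · exfalso
    rw [leftInvSeq_altWord, List.mem_map] at hm
    obtain ⟨p, hp, he⟩ := hm
    rw [List.mem_range] at hp
    have : (cs.simple i * cs.simple j) ^ (p + 1) = 1 := by
      rw [pow_succ, ← mul_assoc, he]; simp
    have hd := dvd_of_pow_eq_one cs hij _ this
    rcases hk with hk | hk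
    · rw [hk] at hd; simp at hd
    · have := Nat.le_of_dvd (by omega) hd
      omega
  · rw [List.mem_map] at hm
    obtain ⟨r, hr', he⟩ := hm
    obtain ⟨q, hq, rfl⟩ := List.getElem_of_mem hr'
    rw [length_leftInvSeq] at hq
    have hz := cs.getD_leftInvSeq_mul_wordProd z q
    rw [List.getD_eq_getElem _ _ (by simpa using hq)] at hz
    have hw : cs.wordProd (altWord j i (k + 1) ++ z.eraseIdx q) = x := by
      rw [altWord, List.cons_append, wordProd_cons, wordProd_append, ← hz, ← he, ← hx,
        wordProd_append]
      have hsq := cs.getD_leftInvSeq_mul_self z q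
      rw [List.getD_eq_getElem _ _ (by simpa using hq)] at hsq
      simp only [MulAut.conj_apply, mul_assoc, inv_mul_cancel_left]
      rw [← mul_assoc _ _ (cs.wordProd z), hsq, one_mul]
    refine ⟨z.eraseIdx q, ?_, hw⟩
    rw [CoxeterSystem.IsReduced, hw, ← hx, hr.eq]
    simp [length_altWord, List.length_eraseIdx, hq]
    omega

theorem exists_alt (k : ℕ) : ∀ {x : W} {i j : B}, i ≠ j → cs.IsLeftDescent x i →
    cs.IsLeftDescent x j → (M i j = 0 ∨ k ≤ M i j) →
    ∃ z, cs.IsReduced (altWord i j k ++ z) ∧ cs.wordProd (altWord i j k ++ z) = x := by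
  induction k with
  | zero =>
    intro x i j _ _ _ _
    obtain ⟨ω, h, e⟩ := cs.exists_isReduced x
    exact ⟨ω, h, e.symm⟩
  | succ k ih =>
    intro x i j hij hi hj hk
    rw [M.symmetric] at hk
    obtain ⟨z, hz, he⟩ := ih hij.symm hj hi (by omega)
    exact step cs hij.symm hi (by omega) hz he

theorem exists_braid {x : W} {i j : B} (hij : i ≠ j) (hi : cs.IsLeftDescent x i)
    (hj : cs.IsLeftDescent x j) : M i j ≠ 0 ∧
    ∃ z, cs.IsReduced (altWord i j (M i j) ++ z) ∧
      cs.wordProd (altWord i j (M i j) ++ z) = x := by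
  refine ⟨fun h0 => ?_, exists_alt cs _ hij hi hj (Or.inr le_rfl)⟩
  obtain ⟨z, hz, he⟩ := exists_alt cs (cs.length x + 1) hij hi hj (Or.inl h0)
  have := hz.eq
  rw [he, List.length_append, length_altWord] at this
  omega

end Exchange

/-! ### Moves -/

section Moves

variable {B W : Type*} [Group W] {M : CoxeterMatrix B} (cs : CoxeterSystem M W)

theorem braidMove_symm {a b : List B} (h : braidMove M a b) : braidMove M b a := by
  obtain ⟨u, v, s, t, h0, h1, h2⟩ := h
  exact ⟨u, v, t, s, by rwa [M.symmetric], by rw [h2, M.symmetric], by rw [h1, M.symmetric]⟩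

theorem braidMove_cons (i : B) {a b : List B} (h : braidMove M a b) :
    braidMove M (i :: a) (i :: b) := by
  obtain ⟨u, v, s, t, h0, rfl, rfl⟩ := h
  exact ⟨i :: u, v, s, t, h0, rfl, rfl⟩

theorem delMove_cons (i : B) {a b : List B} (h : delMove a b) :
    delMove (i :: a) (i :: b) := by
  obtain ⟨u, v, s, rfl, rfl⟩ := h
  exact ⟨i :: u, v, s, rfl, rfl⟩

theorem lift_cons {r r' : List B → List B → Prop} (i : B)
    (hr : ∀ a b, r a b → r' (i :: a) (i :: b)) {a b : List B} (h : Relation.ReflTransGen r a b) :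
    Relation.ReflTransGen r' (i :: a) (i :: b) := by
  induction h with
  | refl => exact Relation.ReflTransGen.refl
  | tail _ h ih => exact ih.tail (hr _ _ h)

theorem wordProd_altWord_comm (s t : B) :
    cs.wordProd (altWord s t (M s t)) = cs.wordProd (altWord t s (M s t)) := by
  have aux : ∀ (k : ℕ) (s t : B), altWord s t k =
      if Even k then alternatingWord s t k else alternatingWord t s k := by
    intro k
    induction k with
    | zero => intro s t; simp [altWord, alternatingWord]
    | succ k ih =>
      intro s t
      rw [altWord, ih, alternatingWord_succ', alternatingWord_succ']
      simp only [Nat.even_add_one]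
      split_ifs <;> simp_all
  have h := cs.wordProd_braidWord_eq s t
  rw [braidWord, braidWord, M.symmetric t s] at h
  rw [aux, aux]
  split_ifs
  · exact h
  · exact h.symm

theorem wordProd_braidMove {a b : List B} (h : braidMove M a b) :
    cs.wordProd a = cs.wordProd b := by
  obtain ⟨u, v, s, t, h0, rfl, rfl⟩ := h
  rw [wordProd_append, wordProd_append, wordProd_append, wordProd_append,
    wordProd_altWord_comm cs s t]

theorem wordProd_delMove {a b : List B} (h : delMove a b) :
    cs.wordProd a = cs.wordProd b := by
  obtain ⟨u, v, s, rfl, rfl⟩ := h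
  simp [wordProd_append, wordProd_cons]

theorem isLeftDescent_of_cons {i : B} {u : List B} (h : cs.IsReduced (i :: u)) :
    cs.IsLeftDescent (cs.wordProd (i :: u)) i := by
  rw [IsLeftDescent, h.eq, wordProd_cons, simple_mul_simple_cancel_left]
  have := cs.length_wordProd_le u
  simp; omega

theorem IsReduced_tail {i : B} {u : List B} (h : cs.IsReduced (i :: u)) : cs.IsReduced u := by
  simpa using h.drop 1

theorem matsumoto (n : ℕ) : ∀ w w' : List B, w.length = n → cs.IsReduced w → cs.IsReduced w' →
    cs.wordProd w = cs.wordProd w' → Relation.ReflTransGen (braidMove M) w w' := by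
  induction n with
  | zero =>
    intro w w' hl hw hw' he
    have h2 := hw'.eq
    rw [← he, hw.eq, hl] at h2
    rw [List.length_eq_zero_iff.mp hl, List.length_eq_zero_iff.mp h2.symm]
  | succ n ih =>
    have same : ∀ (i : B) (u v : List B), u.length = n → cs.IsReduced (i :: u) →
        cs.IsReduced (i :: v) → cs.wordProd (i :: u) = cs.wordProd (i :: v) →
        Relation.ReflTransGen (braidMove M) (i :: u) (i :: v) := by
      intro i u v hl hu hv he
      rw [wordProd_cons, wordProd_cons, mul_right_inj] at he
      exact lift_cons i (fun _ _ h => braidMove_cons i h)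
        (ih u v hl (IsReduced_tail cs hu) (IsReduced_tail cs hv) he)
    intro w w' hl hw hw' he
    have hl' := hw'.eq
    rw [← he, hw.eq, hl] at hl'
    obtain ⟨i, u, rfl⟩ := List.exists_cons_of_length_eq_add_one hl
    obtain ⟨j, v, rfl⟩ := List.exists_cons_of_length_eq_add_one hl'.symm
    by_cases hij : i = j
    · subst hij
      exact same i u v (by simpa using hl) hw hw' he
    have hi := isLeftDescent_of_cons cs hw
    have hj := isLeftDescent_of_cons cs hw'
    rw [← he] at hj
    obtain ⟨h0, z, hz, hze⟩ := exists_braid cs hij hi hj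
    have hmove : braidMove M (altWord i j (M i j) ++ z) (altWord j i (M i j) ++ z) :=
      ⟨[], z, i, j, h0, rfl, rfl⟩
    have hze' := wordProd_braidMove cs hmove
    have hz' : cs.IsReduced (altWord j i (M i j) ++ z) := by
      rw [CoxeterSystem.IsReduced, ← hze', hz.eq]; simp [length_altWord]
    obtain ⟨k, hk⟩ := Nat.exists_eq_succ_of_ne_zero h0
    simp only [hk, Nat.succ_eq_add_one, altWord, List.cons_append] at hmove hz hz' hze hze'
    refine (same i u _ (by simpa using hl) hw hz hze.symm).trans
      (Relation.ReflTransGen.head hmove (same j _ v ?_ hz' hw' ?_))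
    · have := hz'.eq
      rw [← hze', hze, hw.eq, hl] at this
      simpa using this.symm
    · exact (hze'.symm.trans hze).trans he

theorem shorten : ∀ w : List B, ¬ cs.IsReduced w → ∃ w' : List B,
    Relation.ReflTransGen (fun a b => delMove a b ∨ braidMove M a b) w w' ∧
      w'.length < w.length := by
  intro w
  induction w with
  | nil => intro h; exact absurd (by simp [CoxeterSystem.IsReduced]) h
  | cons i w ih =>
    intro h
    by_cases hw : cs.IsReduced w
    · have hd : cs.IsLeftDescent (cs.wordProd w) i := by
        by_contra hn
        rw [not_isLeftDescent_iff, ← wordProd_cons, hw.eq] at hn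
        exact h hn
      obtain ⟨v, hv, he⟩ := exists_cons cs hd
      have hb := matsumoto cs _ w (i :: v) rfl hw hv he.symm
      refine ⟨v, ?_, ?_⟩
      · refine Relation.ReflTransGen.tail (b := i :: i :: v) ?_ (Or.inl ⟨[], v, i, rfl, rfl⟩)
        exact lift_cons i
          (fun _ _ h => Or.inr (braidMove_cons i h)) hb
      · have := hv.eq
        rw [he, hw.eq] at this
        simp at this ⊢
        omega
    · obtain ⟨w', h1, h2⟩ := ih hw
      refine ⟨i :: w', ?_, by simpa using h2⟩
      exact lift_cons i
        (fun _ _ h => h.imp (delMove_cons i) (braidMove_cons i)) h1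

theorem wordProd_moves {a b : List B}
    (h : Relation.ReflTransGen (fun a b => delMove a b ∨ braidMove M a b) a b) :
    cs.wordProd a = cs.wordProd b := by
  induction h with
  | refl => rfl
  | tail _ h ih => exact ih.trans (h.elim (wordProd_delMove cs) (wordProd_braidMove cs))

end Moves

end TitsAux

/-- **Tits.** Let `W` be a Coxeter group with Coxeter system `cs`. Then:
(1) a word over `S` is a reduced expression (of the element it represents) if and only if
it is M-reduced; and (2) any two reduced expressions of the same element of `W` are
connected by a finite sequence of braid-relation substitutions. -/
theorem tits_solution_word_problem {B W : Type*} [Group W] {M : CoxeterMatrix B}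
    (cs : CoxeterSystem M W) :
    (∀ w : List B, cs.IsReduced w ↔ MReduced M w) ∧
    (∀ w w' : List B, cs.IsReduced w → cs.IsReduced w' →
      cs.wordProd w = cs.wordProd w' →
      Relation.ReflTransGen (braidMove M) w w') := by
  refine ⟨fun w => ⟨fun h w' hm => ?_, fun h => ?_⟩, fun w w' h h' he =>
    TitsAux.matsumoto cs _ w w' rfl h h' he⟩
  · rw [← h.eq, TitsAux.wordProd_moves cs hm]
    exact cs.length_wordProd_le w'
  · by_contra hn
    obtain ⟨w', h1, h2⟩ := TitsAux.shorten cs w hn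
    exact absurd (h w' h1) (by omega)
end
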